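/- arXiv:1911.08200 — 2 statements merged into one kernel-verified Lean document; each statement's English description precedes it below -/
import Mathlib

section
/- Suppose the configuration space is finite, Θ = {θ_1,…,θ_m}. Let θ† = argmax_{θ∈Θ} τ²_θ, and set τ² = τ²_{θ†}, σ²_WI = σ²_WI(θ†), σ²_AI = σ²_AI(θ†), n = max{n_1,…,n_K}, and C = U − L. Then for any 0 < δ < 1, with probability at least 1 − δ over the draw of the training instances and random seeds, sup_{θ∈Θ} [u(θ) − û_{S_N}(θ)] ≤ (2nC·ln(m/δ))/(3N) + sqrt( 2·ln(m/δ)·( (1/N)·σ²_WI + (Σ_{i=1}^K n_i² / N²)·σ²_AI ) ). -/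
open MeasureTheory

/-- The sampling measure: `K` training instances drawn i.i.d. from `D` and
`N` random seeds drawn i.i.d. from `G`, independently of the instances. -/
noncomputable def sampleMeasure {Z V : Type*} [MeasurableSpace Z] [MeasurableSpace V]
    (D : Measure Z) (G : Measure V) (K N : ℕ) :
    Measure ((Fin K → Z) × (Fin N → V)) :=
  (Measure.pi fun _ : Fin K => D).prod (Measure.pi fun _ : Fin N => G)

/-- True performance `u(θ) = E_{z∼D, v∼G}[f_θ(z,v)]`. -/
noncomputable def truePerf {Z V : Type*} [MeasurableSpace Z] [MeasurableSpace V]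
    (D : Measure Z) (G : Measure V) (f : Z × V → ℝ) : ℝ :=
  ∫ zv, f zv ∂(D.prod G)

/-- Within-instance mean `u_z = E_{v∼G}[f(z,v)]`. -/
noncomputable def instPerf {Z V : Type*} [MeasurableSpace V]
    (G : Measure V) (f : Z × V → ℝ) (z : Z) : ℝ :=
  ∫ v, f (z, v) ∂G

/-- Expected within-instance variance `σ²_WI = E_{z∼D}[E_{v∼G}[(f(z,v) − u_z)²]]`. -/
noncomputable def sigma2WI {Z V : Type*} [MeasurableSpace Z] [MeasurableSpace V]
    (D : Measure Z) (G : Measure V) (f : Z × V → ℝ) : ℝ :=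
  ∫ z, (∫ v, (f (z, v) - instPerf G f z) ^ 2 ∂G) ∂D

/-- Across-instance variance `σ²_AI = E_{z∼D}[(u_z − u)²]`. -/
noncomputable def sigma2AI {Z V : Type*} [MeasurableSpace Z] [MeasurableSpace V]
    (D : Measure Z) (G : Measure V) (f : Z × V → ℝ) : ℝ :=
  ∫ z, (instPerf G f z - truePerf D G f) ^ 2 ∂D

/-- The number `n_i` of runs performed on the `i`-th training instance, for an
assignment `a : Fin N → Fin K` of each of the `N` runs to a training instance. -/
def nCount {K N : ℕ} (a : Fin N → Fin K) (i : Fin K) : ℕ :=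
  (Finset.univ.filter fun t => a t = i).card

/-- `τ²_θ = σ²_WI(θ) + (Σ_i n_i² / N)·σ²_AI(θ)`. -/
noncomputable def tau2 {Z V : Type*} [MeasurableSpace Z] [MeasurableSpace V]
    (D : Measure Z) (G : Measure V) (f : Z × V → ℝ)
    {K N : ℕ} (a : Fin N → Fin K) : ℝ :=
  sigma2WI D G f + ((∑ i : Fin K, (nCount a i : ℝ) ^ 2) / (N : ℝ)) * sigma2AI D G f


lemma exp_le_quad_neg {y : ℝ} (hy : y ≤ 0) : Real.exp y ≤ 1 + y + y ^ 2 / 2 := by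
  have hd : ∀ x : ℝ, HasDerivAt (fun x : ℝ => 1 + x + x ^ 2 / 2 - Real.exp x)
      (1 + x - Real.exp x) x := by
    intro x
    have := (((hasDerivAt_id x).const_add 1).add (((hasDerivAt_id x).pow 2).div_const 2)).sub
      (Real.hasDerivAt_exp x)
    refine this.congr_deriv ?_
    simp
  have hanti : Antitone (fun x : ℝ => 1 + x + x ^ 2 / 2 - Real.exp x) := by
    refine antitone_of_deriv_nonpos (fun x => (hd x).differentiableAt) ?_
    intro x
    rw [(hd x).deriv]
    have := Real.add_one_le_exp x
    linarith
  have := hanti hy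
  simp at this
  linarith

lemma exp_le_bern_pos {y : ℝ} (hy : 0 ≤ y) :
    (1 - y / 3) * Real.exp y ≤ 1 + 2 * y / 3 + y ^ 2 / 6 := by
  have hd : ∀ x : ℝ, HasDerivAt
      (fun x : ℝ => Real.exp (-x) * (1 + 2 * x / 3 + x ^ 2 / 6) + x / 3)
      (1 / 3 - Real.exp (-x) * (1 + x + x ^ 2 / 2) / 3) x := by
    intro x
    have h1 : HasDerivAt (fun x : ℝ => Real.exp (-x)) (Real.exp (-x) * (-1)) x :=
      (hasDerivAt_neg x).exp
    have h2 : HasDerivAt (fun x : ℝ => 1 + 2 * x / 3 + x ^ 2 / 6)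
        (2 * 1 / 3 + (2 : ℕ) * x ^ (2 - 1) * 1 / 6) x :=
      ((((hasDerivAt_id x).const_mul 2).div_const 3).const_add 1).add
        (((hasDerivAt_id x).pow 2).div_const 6)
    have := (h1.mul h2).add ((hasDerivAt_id x).div_const 3)
    refine this.congr_deriv ?_
    push_cast
    ring
  have hmono : MonotoneOn (fun x : ℝ => Real.exp (-x) * (1 + 2 * x / 3 + x ^ 2 / 6) + x / 3)
      (Set.Ici 0) := by
    refine monotoneOn_of_deriv_nonneg (convex_Ici 0)
      (fun x _ => (hd x).continuousAt.continuousWithinAt)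
      (fun x _ => (hd x).differentiableAt.differentiableWithinAt) ?_
    intro x hx
    rw [interior_Ici] at hx
    rw [(hd x).deriv]
    have h := Real.quadratic_le_exp_of_nonneg (le_of_lt hx)
    have h2 : Real.exp (-x) * (1 + x + x ^ 2 / 2) ≤ Real.exp (-x) * Real.exp x := by gcongr
    rw [← Real.exp_add] at h2
    simp at h2
    linarith
  have h := hmono (Set.mem_Ici.2 le_rfl) (Set.mem_Ici.2 hy) hy
  simp at h
  have h3 : Real.exp (-y) * Real.exp y = 1 := by rw [← Real.exp_add]; simp
  have h4 := mul_le_mul_of_nonneg_right h (Real.exp_pos y).le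
  have h5 : (Real.exp (-y) * (1 + 2 * y / 3 + y ^ 2 / 6) + y / 3) * Real.exp y
    = (Real.exp (-y) * Real.exp y) * (1 + 2 * y / 3 + y ^ 2 / 6) + y / 3 * Real.exp y := by ring
  rw [h5, h3] at h4
  linarith

lemma exp_le_bern {y b : ℝ} (hb0 : 0 ≤ b) (hb : b < 3) (hy : y ≤ b) :
    Real.exp y ≤ 1 + y + y ^ 2 / (2 * (1 - b / 3)) := by
  rcases le_total y 0 with h | h
  · refine (exp_le_quad_neg h).trans ?_
    have : y ^ 2 / 2 ≤ y ^ 2 / (2 * (1 - b / 3)) := by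
      apply div_le_div_of_nonneg_left (sq_nonneg y) (by linarith) (by linarith)
    linarith
  · have h1 := exp_le_bern_pos h
    have h2 : 0 < 1 - y / 3 := by linarith
    have h3 : y ^ 2 / (2 * (1 - y / 3)) ≤ y ^ 2 / (2 * (1 - b / 3)) := by
      apply div_le_div_of_nonneg_left (sq_nonneg y) (by linarith) (by linarith)
    have h4 : Real.exp y ≤ (1 + 2 * y / 3 + y ^ 2 / 6) / (1 - y / 3) := by
      rw [le_div_iff₀ h2]; linarith
    have h5 : (1 + 2 * y / 3 + y ^ 2 / 6) / (1 - y / 3) = 1 + y + y ^ 2 / (2 * (1 - y / 3)) := by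
      have : 3 - y ≠ 0 := by linarith
      have : 1 - y / 3 ≠ 0 := h2.ne'
      rw [div_eq_iff this]
      have : y ^ 2 / (2 * (1 - y / 3)) * (1 - y / 3) = y ^ 2 / 2 := by field_simp
      rw [add_mul, this]; ring
    linarith

lemma exists_lambda {M v x : ℝ} (hM : 0 < M) (hv : 0 ≤ v) (hx : 0 < x) :
    ∃ l : ℝ, 0 ≤ l ∧ l * M < 3 ∧
      x ≤ l * (2 * M * x / 3 + Real.sqrt (2 * x * v)) - l ^ 2 / (2 * (1 - l * M / 3)) * v := by
  rcases hv.eq_or_lt with rfl | hv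
  · refine ⟨3 / (2 * M), by positivity, ?_, ?_⟩
    · have : 3 / (2 * M) * M = 3 / 2 := by field_simp
      rw [this]; norm_num
    · simp only [mul_zero, Real.sqrt_zero, add_zero, sub_zero]
      apply le_of_eq; field_simp
  · set r := Real.sqrt (2 * x * v) with hr
    have hr2 : r ^ 2 = 2 * x * v := Real.sq_sqrt (by positivity)
    have hrp : 0 < r := Real.sqrt_pos.2 (by positivity)
    set s := r / v with hs
    have hsp : 0 < s := by positivity
    have hrs : r = s * v := by rw [hs]; field_simp
    have hsv : s ^ 2 * v = 2 * x := by
      have : (s ^ 2 * v) * v = 2 * x * v := by rw [← hr2, hrs]; ring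
      exact mul_right_cancel₀ hv.ne' this
    have hq : 0 < 1 + M / 3 * s := by positivity
    refine ⟨s / (1 + M / 3 * s), by positivity, ?_, ?_⟩
    · rw [div_mul_eq_mul_div, div_lt_iff₀ hq]; nlinarith
    · have e1 : 1 - s / (1 + M / 3 * s) * M / 3 = 1 / (1 + M / 3 * s) := by
        field_simp; ring
      rw [e1]
      have e2 : (s / (1 + M / 3 * s)) ^ 2 / (2 * (1 / (1 + M / 3 * s))) * v
          = x / (1 + M / 3 * s) := by
        have : (s / (1 + M / 3 * s)) ^ 2 / (2 * (1 / (1 + M / 3 * s))) * v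
          = (s ^ 2 * v) / (2 * (1 + M / 3 * s)) := by field_simp
        rw [this, hsv]; field_simp
      have e3 : s / (1 + M / 3 * s) * (2 * M * x / 3 + r) = 2 * x := by
        have : s * (2 * M * x / 3 + r) = 2 * x * (1 + M / 3 * s) := by
          rw [hrs]; linear_combination hsv
        rw [div_mul_eq_mul_div, this]; field_simp
      rw [e2, e3]
      have : x / (1 + M / 3 * s) ≤ x := div_le_self hx.le (by nlinarith [mul_pos hM hsp])
      linarith

lemma integrable_of_bdd {α : Type*} [MeasurableSpace α] {μ : Measure α} [IsFiniteMeasure μ]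
    {g : α → ℝ} (hg : Measurable g) (C : ℝ) (h : ∀ x, |g x| ≤ C) : Integrable g μ :=
  Integrable.of_bound hg.aestronglyMeasurable C (Filter.Eventually.of_forall h)

lemma inner_bound {V : Type*} [MeasurableSpace V] (G : Measure V) [IsProbabilityMeasure G]
    (g : V → ℝ) (hg : Measurable g) (C : ℝ) (hC : ∀ v, |g v| ≤ C) (k : ℕ) (l b : ℝ)
    (hl : 0 ≤ l) (hb0 : 0 ≤ b) (hb : b < 3) (hlb : l * (k * C) ≤ b) :
    (∫ v, Real.exp (l * g v) ∂G) ^ k ≤ 1 + l * (k * ∫ v, g v ∂G)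
      + l ^ 2 / (2 * (1 - b / 3)) * (k * (∫ v, (g v - ∫ w, g w ∂G) ^ 2 ∂G)
          + k ^ 2 * (∫ v, g v ∂G) ^ 2) := by
  set P := Measure.pi (fun _ : Fin k => G) with hP
  set Y : (Fin k → V) → ℝ := fun v => ∑ j, g (v j) with hY
  have hYm : Measurable Y := by fun_prop
  have hYb : ∀ v, |Y v| ≤ k * C := by
    intro v
    refine (Finset.abs_sum_le_sum_abs _ _).trans ?_
    refine (Finset.sum_le_sum fun i _ => hC (v i)).trans ?_
    simp
  have hgi : Integrable g G := integrable_of_bdd hg C hC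
  have hgL : MemLp g 2 G := MemLp.of_bound hg.aestronglyMeasurable C (Filter.Eventually.of_forall hC)
  have hYi : Integrable Y P := integrable_of_bdd hYm _ hYb
  have hYL : MemLp Y 2 P :=
    MemLp.of_bound hYm.aestronglyMeasurable _ (Filter.Eventually.of_forall hYb)
  have h1 : (∫ v, Real.exp (l * g v) ∂G) ^ k = ∫ v, Real.exp (l * Y v) ∂P := by
    have := integral_fintype_prod_eq_pow (ι := Fin k) (𝕜 := ℝ) (μ := G) (fun v => Real.exp (l * g v))
    rw [Fintype.card_fin] at this
    rw [← this]
    congr 1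
    ext v
    rw [← Real.exp_sum, hY, Finset.mul_sum]
  have hmean : ∫ v, Y v ∂P = k * ∫ v, g v ∂G := by
    rw [hY, integral_finsetSum _ (fun i _ => integrable_comp_eval hgi)]
    rw [Finset.sum_congr rfl (fun i _ => integral_comp_eval (μ := fun _ : Fin k => G) (i := i) hg.aestronglyMeasurable)]
    simp
  have hvar : ∫ v, Y v ^ 2 ∂P = k * (∫ v, (g v - ∫ w, g w ∂G) ^ 2 ∂G)
          + k ^ 2 * (∫ v, g v ∂G) ^ 2 := by
    have a1 := ProbabilityTheory.variance_eq_sub hYL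
    have a2 : ProbabilityTheory.variance Y P = k * ProbabilityTheory.variance g G := by
      have := ProbabilityTheory.variance_sum_pi (μ := fun _ : Fin k => G) (X := fun _ => g)
        (fun _ => hgL)
      have e : (∑ i : Fin k, fun ω : Fin k → V => g (ω i)) = Y := by
        ext; simp [hY]
      rw [e] at this
      simpa using this
    rw [ProbabilityTheory.variance_eq_integral hg.aemeasurable] at a2
    rw [a2, hmean] at a1
    simp only [Pi.pow_apply] at a1
    rw [a1]; ring
  rw [h1, ← hvar, ← hmean]
  have hY2 : Integrable (fun v => Y v ^ 2) P := hYL.integrable_sq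
  have hr : ∫ v, (1 + l * Y v + l ^ 2 / (2 * (1 - b / 3)) * Y v ^ 2) ∂P
      = 1 + l * ∫ v, Y v ∂P + l ^ 2 / (2 * (1 - b / 3)) * ∫ v, Y v ^ 2 ∂P := by
    have i1 : Integrable (fun v => 1 + l * Y v) P := (integrable_const _).add (hYi.const_mul _)
    rw [integral_add i1 (hY2.const_mul _),
      integral_add (integrable_const _) (hYi.const_mul _), integral_const_mul, integral_const_mul]
    simp
  rw [← hr]
  refine integral_mono ?_ (((integrable_const _).add (hYi.const_mul _)).add (hY2.const_mul _)) ?_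
  · refine integrable_of_bdd (by fun_prop) (Real.exp b) ?_
    intro v
    rw [abs_of_pos (Real.exp_pos _)]
    exact Real.exp_le_exp.2 ((mul_le_mul_of_nonneg_left ((le_abs_self _).trans (hYb v)) hl).trans hlb)
  · intro v
    have := exp_le_bern hb0 hb
      ((mul_le_mul_of_nonneg_left ((le_abs_self _).trans (hYb v)) hl).trans hlb)
    refine this.trans (le_of_eq ?_)
    simp only
    ring

lemma outer_bound {Z V : Type*} [MeasurableSpace Z] [MeasurableSpace V]
    (D : Measure Z) (G : Measure V) [IsProbabilityMeasure D] [IsProbabilityMeasure G]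
    (L U : ℝ) (f : Z × V → ℝ) (hf : Measurable f) (hbdd : ∀ z v, f (z, v) ∈ Set.Icc L U)
    (k : ℕ) (l b : ℝ)
    (hl : 0 ≤ l) (hb0 : 0 ≤ b) (hb : b < 3) (hlb : l * (k * (U - L)) ≤ b) :
    ∫ z, (∫ v, Real.exp (l * (truePerf D G f - f (z, v))) ∂G) ^ k ∂D ≤
      Real.exp (l ^ 2 / (2 * (1 - b / 3)) * (k * sigma2WI D G f + k ^ 2 * sigma2AI D G f)) := by
  set u := truePerf D G f with hu
  have hfb : ∀ zv, |f zv| ≤ max |L| |U| := fun zv =>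
    abs_le_max_abs_abs (hbdd zv.1 zv.2).1 (hbdd zv.1 zv.2).2
  have hfi : Integrable f (D.prod G) := integrable_of_bdd hf _ hfb
  have huI : u ∈ Set.Icc L U := by
    constructor
    · have := integral_mono (integrable_const L) hfi (fun zv => (hbdd zv.1 zv.2).1)
      simpa [hu, truePerf] using this
    · have := integral_mono hfi (integrable_const U) (fun zv => (hbdd zv.1 zv.2).2)
      simpa [hu, truePerf] using this
  have hfz : ∀ z, Integrable (fun v => f (z, v)) G := fun z =>
    integrable_of_bdd (by fun_prop) _ (fun v => hfb (z, v))
  have hIm : Measurable (instPerf G f) :=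
    (hf.stronglyMeasurable.integral_prod_right' (ν := G)).measurable
  have hII : ∀ z, instPerf G f z ∈ Set.Icc L U := by
    intro z
    constructor
    · have := integral_mono (integrable_const L) (hfz z) (fun v => (hbdd z v).1)
      simpa [instPerf] using this
    · have := integral_mono (hfz z) (integrable_const U) (fun v => (hbdd z v).2)
      simpa [instPerf] using this
  have hC : ∀ z v, |u - f (z, v)| ≤ U - L := fun z v => by
    have h1 := hbdd z v
    rw [abs_le]; constructor <;> linarith [h1.1, h1.2, huI.1, huI.2]
  have hIi : Integrable (instPerf G f) D :=
    integrable_of_bdd hIm _ (fun z => abs_le_max_abs_abs (hII z).1 (hII z).2)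
  have hImean : ∫ z, instPerf G f z ∂D = u := (integral_prod f hfi).symm
  have hWm : Measurable (fun z => ∫ v, (f (z, v) - instPerf G f z) ^ 2 ∂G) := by
    have : Measurable (fun p : Z × V => (f p - instPerf G f p.1) ^ 2) := by fun_prop
    exact (this.stronglyMeasurable.integral_prod_right' (ν := G)).measurable
  have hd : ∀ z v, (f (z, v) - instPerf G f z) ^ 2 ≤ (U - L) ^ 2 := fun z v => by
    apply sq_le_sq'
    · linarith [(hbdd z v).1, (hII z).2]
    · linarith [(hbdd z v).2, (hII z).1]
  have hWi : Integrable (fun z => ∫ v, (f (z, v) - instPerf G f z) ^ 2 ∂G) D := by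
    refine integrable_of_bdd hWm ((U - L) ^ 2) ?_
    intro z
    rw [abs_of_nonneg (integral_nonneg fun v => sq_nonneg _)]
    have := integral_mono (μ := G) (integrable_of_bdd (by fun_prop) ((U - L) ^ 2)
      (fun v => by rw [abs_of_nonneg (sq_nonneg _)]; exact hd z v))
      (integrable_const ((U - L) ^ 2)) (hd z)
    simpa using this
  have hAi : Integrable (fun z => (instPerf G f z - u) ^ 2) D := by
    refine integrable_of_bdd (by fun_prop) ((U - L) ^ 2) ?_
    intro z
    rw [abs_of_nonneg (sq_nonneg _)]
    apply sq_le_sq'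
    · linarith [(hII z).1, huI.2]
    · linarith [(hII z).2, huI.1]
  set c := l ^ 2 / (2 * (1 - b / 3)) with hc
  have key : ∀ z, (∫ v, Real.exp (l * (u - f (z, v))) ∂G) ^ k ≤
      1 + l * (k * (u - instPerf G f z)) + c * (k * (∫ v, (f (z, v) - instPerf G f z) ^ 2 ∂G)
        + k ^ 2 * (instPerf G f z - u) ^ 2) := by
    intro z
    have h := inner_bound G (fun v => u - f (z, v)) (by fun_prop) (U - L) (hC z) k l b hl hb0 hb hlb
    have hm : ∫ v, (u - f (z, v)) ∂G = u - instPerf G f z := by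
      rw [integral_sub (integrable_const _) (hfz z)]
      simp [instPerf]
    rw [hm] at h
    have e : ∀ v, (u - f (z, v) - (u - instPerf G f z)) ^ 2 = (f (z, v) - instPerf G f z) ^ 2 :=
      fun v => by ring
    simp only [e] at h
    rw [← hc] at h
    refine h.trans (le_of_eq ?_)
    ring
  have hint1 : Integrable (fun z => 1 + l * (k * (u - instPerf G f z))) D :=
    (integrable_const _).add ((((integrable_const _).sub hIi).const_mul _).const_mul _)
  have hint2 : Integrable (fun z => c * (k * (∫ v, (f (z, v) - instPerf G f z) ^ 2 ∂G)
        + k ^ 2 * (instPerf G f z - u) ^ 2)) D :=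
    ((hWi.const_mul _).add (hAi.const_mul _)).const_mul _
  have hmono := integral_mono_of_nonneg (μ := D)
    (f := fun z => (∫ v, Real.exp (l * (u - f (z, v))) ∂G) ^ k)
    (Filter.Eventually.of_forall fun z =>
      pow_nonneg (integral_nonneg fun v => (Real.exp_pos _).le) k)
    (hint1.add hint2) (Filter.Eventually.of_forall key)
  refine hmono.trans ?_
  have e1 : ∫ z, (1 + l * (k * (u - instPerf G f z))) ∂D = 1 := by
    have i1 : Integrable (fun z => u - instPerf G f z) D := (integrable_const _).sub hIi
    rw [integral_add (integrable_const _) ((i1.const_mul _).const_mul _),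
      integral_const_mul, integral_const_mul, integral_sub (integrable_const _) hIi, hImean]
    simp
  have e2 : ∫ z, (c * (k * (∫ v, (f (z, v) - instPerf G f z) ^ 2 ∂G)
        + k ^ 2 * (instPerf G f z - u) ^ 2)) ∂D
        = c * (k * sigma2WI D G f + k ^ 2 * sigma2AI D G f) := by
    rw [integral_const_mul, integral_add (hWi.const_mul _) (hAi.const_mul _),
      integral_const_mul, integral_const_mul]
    rfl
  have e3 := integral_add hint1 hint2
  rw [e1, e2] at e3
  refine le_trans (le_of_eq e3) ?_
  have := Real.add_one_le_exp (c * (k * sigma2WI D G f + k ^ 2 * sigma2AI D G f))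
  linarith

lemma sum_nCount {K N : ℕ} (a : Fin N → Fin K) : ∑ i, nCount a i = N := by
  have := Finset.card_eq_sum_card_fiberwise (f := a) (s := Finset.univ) (t := Finset.univ)
    (fun _ _ => Finset.mem_coe.2 (Finset.mem_univ _))
  simpa [nCount] using this.symm

lemma mgf_bound {Z V : Type*} [MeasurableSpace Z] [MeasurableSpace V]
    (D : Measure Z) (G : Measure V) [IsProbabilityMeasure D] [IsProbabilityMeasure G]
    (L U : ℝ) (f : Z × V → ℝ) (hf : Measurable f) (hbdd : ∀ z v, f (z, v) ∈ Set.Icc L U)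
    (hLU : L ≤ U) {K N : ℕ} (a : Fin N → Fin K) (l : ℝ) (hl : 0 ≤ l)
    (hb : l * (((Finset.univ.sup (nCount a) : ℕ) : ℝ) * (U - L)) < 3)
    (hint : Integrable (fun ω : (Fin K → Z) × (Fin N → V) =>
      Real.exp (l * ∑ t, (truePerf D G f - f (ω.1 (a t), ω.2 t)))) (sampleMeasure D G K N)) :
    ∫ ω, Real.exp (l * ∑ t, (truePerf D G f - f (ω.1 (a t), ω.2 t))) ∂(sampleMeasure D G K N)
      ≤ Real.exp (l ^ 2 / (2 * (1 - l * (((Finset.univ.sup (nCount a) : ℕ) : ℝ) * (U - L)) / 3))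
        * (N * sigma2WI D G f + (∑ i, (nCount a i : ℝ) ^ 2) * sigma2AI D G f)) := by
  set M := ((Finset.univ.sup (nCount a) : ℕ) : ℝ) * (U - L) with hM
  have hM0 : 0 ≤ M := mul_nonneg (Nat.cast_nonneg _) (by linarith)
  set u := truePerf D G f with hu
  have h1 : ∫ ω, Real.exp (l * ∑ t, (u - f (ω.1 (a t), ω.2 t))) ∂(sampleMeasure D G K N)
      = ∏ i, ∫ z, (∫ v, Real.exp (l * (u - f (z, v))) ∂G) ^ (nCount a i) ∂D := by
    unfold sampleMeasure at hint ⊢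
    rw [integral_prod _ hint]
    rw [← integral_fintype_prod_eq_prod (𝕜 := ℝ) (μ := fun _ : Fin K => D)
      (fun i z => (∫ v, Real.exp (l * (u - f (z, v))) ∂G) ^ (nCount a i))]
    congr 1
    ext z
    simp only [Finset.mul_sum, Real.exp_sum]
    rw [integral_fintype_prod_eq_prod (𝕜 := ℝ) (μ := fun _ : Fin N => G)
      (fun t v => Real.exp (l * (u - f (z (a t), v))))]
    rw [← Finset.prod_fiberwise_of_maps_to' (s := Finset.univ) (t := Finset.univ) (g := a)
      (fun _ _ => Finset.mem_univ _) (fun i => ∫ v, Real.exp (l * (u - f (z i, v))) ∂G)]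
    simp [nCount, Finset.prod_const]
  rw [h1]
  refine (Finset.prod_le_prod (fun i _ => integral_nonneg fun z =>
      pow_nonneg (integral_nonneg fun v => (Real.exp_pos _).le) _)
    (fun i _ => outer_bound D G L U f hf hbdd (nCount a i) l (l * M) hl (by positivity) hb ?_)).trans ?_
  · have : nCount a i ≤ Finset.univ.sup (nCount a) := Finset.le_sup (Finset.mem_univ i)
    have h2 : (nCount a i : ℝ) ≤ ((Finset.univ.sup (nCount a) : ℕ) : ℝ) := by exact_mod_cast this
    exact mul_le_mul_of_nonneg_left (mul_le_mul_of_nonneg_right h2 (by linarith)) hl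
  · rw [← Real.exp_sum, ← Finset.mul_sum, Finset.sum_add_distrib, ← Finset.sum_mul,
      ← Finset.sum_mul, ← Nat.cast_sum, sum_nCount]

lemma single_bound {Z V : Type*} [MeasurableSpace Z] [MeasurableSpace V]
    (D : Measure Z) (G : Measure V) [IsProbabilityMeasure D] [IsProbabilityMeasure G]
    (L U : ℝ) (f : Z × V → ℝ) (hf : Measurable f) (hbdd : ∀ z v, f (z, v) ∈ Set.Icc L U)
    (hLU : L ≤ U) {K N : ℕ} (hN : 1 ≤ N) (a : Fin N → Fin K) (v x : ℝ) (hx : 0 < x)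
    (hv : N * sigma2WI D G f + (∑ i, (nCount a i : ℝ) ^ 2) * sigma2AI D G f ≤ v) :
    (sampleMeasure D G K N).real {ω : (Fin K → Z) × (Fin N → V) |
      2 * (((Finset.univ.sup (nCount a) : ℕ) : ℝ) * (U - L)) * x / 3 + Real.sqrt (2 * x * v)
        < ∑ t, (truePerf D G f - f (ω.1 (a t), ω.2 t))} ≤ Real.exp (-x) := by
  have : IsProbabilityMeasure (sampleMeasure D G K N) := by
    unfold sampleMeasure; infer_instance
  set M := ((Finset.univ.sup (nCount a) : ℕ) : ℝ) * (U - L) with hM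
  set u := truePerf D G f with hu
  have hfb : ∀ zv, |f zv| ≤ max |L| |U| := fun zv =>
    abs_le_max_abs_abs (hbdd zv.1 zv.2).1 (hbdd zv.1 zv.2).2
  have hfi : Integrable f (D.prod G) := integrable_of_bdd hf _ hfb
  have huU : u ≤ U := by
    have := integral_mono hfi (integrable_const U) (fun zv => (hbdd zv.1 zv.2).2)
    simpa [hu, truePerf] using this
  have hS : ∀ ω : (Fin K → Z) × (Fin N → V),
      ∑ t, (u - f (ω.1 (a t), ω.2 t)) ≤ N * (U - L) := by
    intro ω
    refine (Finset.sum_le_sum (fun t _ => (by linarith [(hbdd (ω.1 (a t)) (ω.2 t)).1] :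
      u - f (ω.1 (a t), ω.2 t) ≤ U - L))).trans ?_
    rw [Finset.sum_const, Finset.card_univ, Fintype.card_fin, nsmul_eq_mul]
  have hn : 1 ≤ Finset.univ.sup (nCount a) := by
    have : nCount a (a ⟨0, hN⟩) ≤ Finset.univ.sup (nCount a) := Finset.le_sup (Finset.mem_univ _)
    refine le_trans ?_ this
    exact Finset.card_pos.2 ⟨⟨0, hN⟩, by simp⟩
  have hv0 : 0 ≤ v := by
    refine le_trans ?_ hv
    have h1 : 0 ≤ sigma2WI D G f := integral_nonneg fun z => integral_nonneg fun v => sq_nonneg _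
    have h2 : 0 ≤ sigma2AI D G f := integral_nonneg fun z => sq_nonneg _
    positivity
  rcases hLU.eq_or_lt with h | h
  · have : {ω : (Fin K → Z) × (Fin N → V) | 2 * M * x / 3 + Real.sqrt (2 * x * v)
        < ∑ t, (u - f (ω.1 (a t), ω.2 t))} = ∅ := by
      ext ω
      simp only [Set.mem_ofPred_eq, Set.mem_empty_iff_false, iff_false, not_lt]
      refine (hS ω).trans ?_
      rw [hM, h]
      simp
    rw [this]
    simp [Real.exp_nonneg]
  · have hM0 : 0 < M := mul_pos (by exact_mod_cast hn) (by linarith)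
    obtain ⟨l, hl, hlM, hlx⟩ := exists_lambda hM0 hv0 hx
    have hint : Integrable (fun ω : (Fin K → Z) × (Fin N → V) =>
        Real.exp (l * ∑ t, (u - f (ω.1 (a t), ω.2 t)))) (sampleMeasure D G K N) := by
      refine integrable_of_bdd (by fun_prop) (Real.exp (l * (N * (U - L)))) ?_
      intro ω
      rw [abs_of_pos (Real.exp_pos _)]
      exact Real.exp_le_exp.2 (mul_le_mul_of_nonneg_left (hS ω) hl)
    have hm := mgf_bound D G L U f hf hbdd hLU a l hl hlM hint
    have hch := ProbabilityTheory.measure_ge_le_exp_mul_mgf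
      (2 * M * x / 3 + Real.sqrt (2 * x * v)) hl hint
    have hsub : {ω : (Fin K → Z) × (Fin N → V) | 2 * M * x / 3 + Real.sqrt (2 * x * v)
          < ∑ t, (u - f (ω.1 (a t), ω.2 t))} ⊆
        {ω : (Fin K → Z) × (Fin N → V) | 2 * M * x / 3 + Real.sqrt (2 * x * v)
          ≤ ∑ t, (u - f (ω.1 (a t), ω.2 t))} := by
      intro ω hω
      rw [Set.mem_ofPred_eq] at hω ⊢
      exact hω.le
    have hmon := measureReal_mono (μ := sampleMeasure D G K N) hsub
    refine hmon.trans (hch.trans ?_)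
    unfold ProbabilityTheory.mgf
    refine (mul_le_mul_of_nonneg_left hm (Real.exp_nonneg _)).trans ?_
    rw [← Real.exp_add, Real.exp_le_exp]
    have hc : 0 ≤ l ^ 2 / (2 * (1 - l * M / 3)) := by
      apply div_nonneg (sq_nonneg _); linarith
    have := mul_le_mul_of_nonneg_left hv hc
    linarith

/-- **Uniform estimation-error bound for a finite configuration space.**
Let `Θ = {θ_1,…,θ_m}` be finite, let `θ†` maximize `τ²_θ`, and set
`σ²_WI = σ²_WI(θ†)`, `σ²_AI = σ²_AI(θ†)`, `n = max_i n_i`, `C = U − L`.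
Then for any `0 < δ < 1`, with probability at least `1 − δ`,
`sup_{θ∈Θ} [u(θ) − û_{S_N}(θ)] ≤ (2nC·ln(m/δ))/(3N)
  + sqrt(2·ln(m/δ)·((1/N)·σ²_WI + (Σ_i n_i²/N²)·σ²_AI))`. -/
theorem finite_space_uniform_error_bound
    {Z V Θ : Type*} [MeasurableSpace Z] [MeasurableSpace V]
    [Fintype Θ] [Nonempty Θ]
    (D : Measure Z) (G : Measure V)
    [IsProbabilityMeasure D] [IsProbabilityMeasure G]
    (L U : ℝ) (hLU : L ≤ U)
    (f : Θ → Z × V → ℝ) (hf : ∀ θ, Measurable (f θ))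
    (hbdd : ∀ θ z v, f θ (z, v) ∈ Set.Icc L U)
    (K N : ℕ) (hN : 1 ≤ N)
    (a : Fin N → Fin K)
    (θd : Θ) (hθd : ∀ θ, tau2 D G (f θ) a ≤ tau2 D G (f θd) a)
    (δ : ℝ) (hδ0 : 0 < δ) (hδ1 : δ < 1) :
    (1 : ℝ) - δ ≤
      (sampleMeasure D G K N
        {ω : (Fin K → Z) × (Fin N → V) |
          (⨆ θ : Θ, (truePerf D G (f θ)
              - (1 / (N : ℝ)) * ∑ t : Fin N, f θ (ω.1 (a t), ω.2 t)))
          ≤ 2 * ((Finset.univ.sup (nCount a) : ℕ) : ℝ) * (U - L)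
              * Real.log ((Fintype.card Θ : ℝ) / δ) / (3 * (N : ℝ))
            + Real.sqrt (2 * Real.log ((Fintype.card Θ : ℝ) / δ)
                * ((1 / (N : ℝ)) * sigma2WI D G (f θd)
                  + ((∑ i : Fin K, (nCount a i : ℝ) ^ 2) / (N : ℝ) ^ 2)
                      * sigma2AI D G (f θd)))}).toReal := by
  have : IsProbabilityMeasure (sampleMeasure D G K N) := by
    unfold sampleMeasure; infer_instance
  have hN0 : (0 : ℝ) < N := by exact_mod_cast hN
  have hm1 : (1 : ℝ) ≤ Fintype.card Θ := by exact_mod_cast Fintype.card_pos (α := Θ)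
  set m : ℝ := ((Fintype.card Θ : ℕ) : ℝ) with hm
  set x := Real.log (m / δ) with hx
  have hxp : 0 < x := Real.log_pos (by rw [lt_div_iff₀ hδ0]; linarith)
  set v : ℝ := N * sigma2WI D G (f θd) + (∑ i, (nCount a i : ℝ) ^ 2) * sigma2AI D G (f θd) with hv
  have htau : ∀ θ, N * sigma2WI D G (f θ) + (∑ i, (nCount a i : ℝ) ^ 2) * sigma2AI D G (f θ)
      = N * tau2 D G (f θ) a := by
    intro θ; unfold tau2; field_simp
  set M := ((Finset.univ.sup (nCount a) : ℕ) : ℝ) * (U - L) with hM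
  set B := 2 * ((Finset.univ.sup (nCount a) : ℕ) : ℝ) * (U - L) * x / (3 * (N : ℝ))
            + Real.sqrt (2 * x * ((1 / (N : ℝ)) * sigma2WI D G (f θd)
                  + ((∑ i : Fin K, (nCount a i : ℝ) ^ 2) / (N : ℝ) ^ 2)
                      * sigma2AI D G (f θd))) with hB
  have hNB : N * B = 2 * M * x / 3 + Real.sqrt (2 * x * v) := by
    have e : 2 * x * v = (N : ℝ) ^ 2 * (2 * x * ((1 / (N : ℝ)) * sigma2WI D G (f θd)
                  + ((∑ i : Fin K, (nCount a i : ℝ) ^ 2) / (N : ℝ) ^ 2)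
                      * sigma2AI D G (f θd))) := by
      rw [hv]; field_simp
    rw [e, Real.sqrt_mul (sq_nonneg _), Real.sqrt_sq hN0.le, hB, mul_add, hM]
    congr 1
    field_simp
  set bad : Θ → Set ((Fin K → Z) × (Fin N → V)) := fun θ =>
    {ω | 2 * M * x / 3 + Real.sqrt (2 * x * v)
        < ∑ t, (truePerf D G (f θ) - f θ (ω.1 (a t), ω.2 t))} with hbad
  have hbadle : ∀ θ, (sampleMeasure D G K N).real (bad θ) ≤ δ / m := by
    intro θ
    have h := single_bound D G L U (f θ) (hf θ) (hbdd θ) hLU hN a v x hxp (by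
      rw [hv, htau, htau]; exact mul_le_mul_of_nonneg_left (hθd θ) hN0.le)
    refine h.trans (le_of_eq ?_)
    rw [hx, Real.exp_neg, Real.exp_log (by positivity), inv_div]
  set S := {ω : (Fin K → Z) × (Fin N → V) |
          (⨆ θ : Θ, (truePerf D G (f θ)
              - (1 / (N : ℝ)) * ∑ t : Fin N, f θ (ω.1 (a t), ω.2 t))) ≤ B} with hS
  have hcov : Set.univ ⊆ S ∪ ⋃ θ, bad θ := by
    intro ω _
    by_cases h : ∃ θ, ω ∈ bad θ
    · exact Or.inr (Set.mem_iUnion.2 h)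
    · left
      push Not at h
      rw [hS, Set.mem_ofPred_eq]
      refine ciSup_le fun θ => ?_
      have h1 := h θ
      simp only [hbad, Set.mem_ofPred_eq, not_lt] at h1
      rw [← hNB, Finset.sum_sub_distrib] at h1
      simp only [Finset.sum_const, Finset.card_univ, Fintype.card_fin, nsmul_eq_mul] at h1
      have e : truePerf D G (f θ) - (1 / (N : ℝ)) * ∑ t : Fin N, f θ (ω.1 (a t), ω.2 t)
        = (N * truePerf D G (f θ) - ∑ t : Fin N, f θ (ω.1 (a t), ω.2 t)) / N := by field_simp
      rw [e, div_le_iff₀ hN0]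
      linarith
  have h1 : (1 : ℝ) ≤ (sampleMeasure D G K N).real S + (sampleMeasure D G K N).real (⋃ θ, bad θ) := by
    have := (measureReal_mono (μ := sampleMeasure D G K N) hcov).trans (measureReal_union_le _ _)
    simpa using this
  have h2 : (sampleMeasure D G K N).real (⋃ θ, bad θ) ≤ δ := by
    refine (measureReal_iUnion_fintype_le _).trans ?_
    refine (Finset.sum_le_sum fun θ _ => hbadle θ).trans ?_
    simp only [Finset.sum_const, Finset.card_univ, nsmul_eq_mul]
    rw [← hm]
    apply le_of_eq; field_simp
  change 1 - δ ≤ (sampleMeasure D G K N).real S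
  linarith
end

section
/- Suppose the configuration space is finite, Θ = {θ_1,…,θ_m}, that K divides N, and that the balanced experimental setting is used, i.e., n_i = N/K for all i ∈ {1,…,K}. Let θ† = argmax_{θ∈Θ} τ²_θ, and set σ²_WI = σ²_WI(θ†), σ²_AI = σ²_AI(θ†), and C = U − L. Then for any 0 < δ < 1, with probability at least 1 − δ over the draw of the training instances and random seeds, sup_{θ∈Θ} [u(θ) − û_{S_N}(θ)] ≤ (2C·ln(m/δ))/(3K) + sqrt( 2·ln(m/δ)·( (1/N)·σ²_WI + (1/K)·σ²_AI ) ). -/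
open MeasureTheory

open ProbabilityTheory in
lemma aux_exp_bound {x c : ℝ} (hx : |x| ≤ c) (hc : c < 3) :
    Real.exp x ≤ 1 + x + 1 / (2 * (1 - c / 3)) * x ^ 2 := by
  have hc0 : 0 ≤ c := (abs_nonneg x).trans hx
  have h1 : HasSum (fun k : ℕ => x ^ (k + 2) / ((k + 2).factorial : ℝ)) (Real.exp x - (1 + x)) := by
    have h := NormedSpace.expSeries_div_hasSum_exp x
    rw [← Real.exp_eq_exp_ℝ] at h
    have h2 := (hasSum_nat_add_iff' 2).mpr h
    simpa [Finset.sum_range_succ] using h2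
  have h2 : HasSum (fun k : ℕ => x ^ 2 / 2 * (c / 3) ^ k) (x ^ 2 / 2 * (1 - c / 3)⁻¹) :=
    (hasSum_geometric_of_lt_one (by positivity) (by linarith)).mul_left _
  have h3 := hasSum_le (fun k => ?_) h1 h2
  · have hne : 1 - c / 3 ≠ 0 := by linarith
    have : x ^ 2 / 2 * (1 - c / 3)⁻¹ = 1 / (2 * (1 - c / 3)) * x ^ 2 := by
      field_simp
    linarith
  · have hfac : (2 : ℝ) * 3 ^ k ≤ ((k + 2).factorial : ℝ) := by
      have := Nat.factorial_mul_pow_le_factorial (m := 2) (n := k)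
      rw [add_comm 2 k] at this
      norm_num at this
      exact_mod_cast this
    calc x ^ (k + 2) / ((k + 2).factorial : ℝ) ≤ |x| ^ (k + 2) / ((k + 2).factorial : ℝ) := by
          refine div_le_div_of_nonneg_right ?_ (by positivity)
          rw [← abs_pow]; exact le_abs_self _
      _ ≤ (|x| ^ 2 * c ^ k) / (2 * 3 ^ k) := by
          rw [pow_add, mul_comm (|x| ^ k)]
          gcongr
      _ = x ^ 2 / 2 * (c / 3) ^ k := by
          rw [sq_abs, div_pow]; field_simp

lemma aux_integrable {Ω : Type*} [MeasurableSpace Ω] (P : Measure Ω) [IsProbabilityMeasure P]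
    {g : Ω → ℝ} (hg : Measurable g) (C : ℝ) (h : ∀ x, |g x| ≤ C) : Integrable g P :=
  Integrable.of_bound hg.aestronglyMeasurable C (Filter.Eventually.of_forall h)

lemma aux_abs_integral {Ω : Type*} [MeasurableSpace Ω] (P : Measure Ω) [IsProbabilityMeasure P]
    {g : Ω → ℝ} (C : ℝ) (h : ∀ x, |g x| ≤ C) : |∫ x, g x ∂P| ≤ C := by
  have := norm_integral_le_of_norm_le_const (μ := P) (f := g) (C := C)
    (Filter.Eventually.of_forall h)
  simpa using this

open ProbabilityTheory in
lemma aux_inner {V : Type*} [MeasurableSpace V] (G : Measure V) [IsProbabilityMeasure G]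
    {g : V → ℝ} (hg : Measurable g) {C : ℝ} (hb : ∀ v, |g v| ≤ C) (n : ℕ) (hn : 0 < n)
    {l : ℝ} (hl : 0 ≤ l) (hlC : l * C < 3) :
    (∫ v, Real.exp (l / n * g v) ∂G) ^ n ≤ 1 + l * ∫ v, g v ∂G
      + 1 / (2 * (1 - l * C / 3)) * l ^ 2 *
        ((∫ v, (g v - ∫ w, g w ∂G) ^ 2 ∂G) / n + (∫ v, g v ∂G) ^ 2) := by
  have hn' : (0 : ℝ) < n := by exact_mod_cast hn
  set P : Measure (Fin n → V) := Measure.pi fun _ => G with hP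
  set X : (Fin n → V) → ℝ := fun w => (n : ℝ)⁻¹ * ∑ i, g (w i) with hX
  have hXm : Measurable X := by
    rw [hX]; fun_prop
  have hXb : ∀ w, |X w| ≤ C := by
    intro w
    have : |∑ i, g (w i)| ≤ n * C := by
      refine (Finset.abs_sum_le_sum_abs _ _).trans ?_
      refine (Finset.sum_le_card_nsmul _ _ C (fun i _ => hb _)).trans ?_
      simp
    rw [hX]
    simp only [abs_mul, abs_inv, Nat.abs_cast]
    rw [inv_mul_le_iff₀ hn']
    exact this
  have hLp : MemLp g 2 G := MemLp.of_bound hg.aestronglyMeasurable C (Filter.Eventually.of_forall hb)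
  have hXLp : MemLp X 2 P := MemLp.of_bound hXm.aestronglyMeasurable C (Filter.Eventually.of_forall hXb)
  have hmean : ∫ w, X w ∂P = ∫ v, g v ∂G := by
    rw [hX, integral_const_mul, integral_finsetSum]
    · have : ∀ i : Fin n, ∫ w, g (w i) ∂P = ∫ v, g v ∂G := fun i => by
        rw [hP]
        exact integral_comp_eval (μ := fun _ : Fin n => G) (i := i) hg.aestronglyMeasurable
      simp only [this]
      simp
      field_simp
    · intro i _
      exact aux_integrable P (by fun_prop) C (fun w => hb _)
  have hvar : Var[X; P] = (∫ v, (g v - ∫ w, g w ∂G) ^ 2 ∂G) / n := by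
    have h1 := variance_sum_pi (μ := fun _ : Fin n => G) (X := fun _ => g) (fun _ => hLp)
    have h2 : X = fun w => (n : ℝ)⁻¹ * (∑ i : Fin n, fun w : Fin n → V => g (w i)) w := by
      rw [hX]; ext w; simp
    rw [h2, variance_const_mul, h1, ← variance_eq_integral hg.aemeasurable]
    simp
    field_simp
  have hsq : ∫ w, X w ^ 2 ∂P = (∫ v, (g v - ∫ w, g w ∂G) ^ 2 ∂G) / n + (∫ v, g v ∂G) ^ 2 := by
    have := variance_eq_sub hXLp
    rw [hvar, hmean] at this
    simp only [Pi.pow_apply] at this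
    linarith
  have hpow : (∫ v, Real.exp (l / n * g v) ∂G) ^ n = ∫ w, Real.exp (l * X w) ∂P := by
    have := integral_fintype_prod_eq_pow (ι := Fin n) (μ := G) (fun v => Real.exp (l / n * g v))
    rw [Fintype.card_fin] at this
    rw [← this]
    refine integral_congr_ae (Filter.Eventually.of_forall fun w => ?_)
    simp only [hX]
    rw [← Real.exp_sum, ← Finset.mul_sum]
    congr 1
    ring
  rw [hpow, ← hsq, ← hmean]
  have hXi : Integrable X P := aux_integrable P hXm C hXb
  have hX2i : Integrable (fun w => X w ^ 2) P := hXLp.integrable_sq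
  have hei : Integrable (fun w => Real.exp (l * X w)) P := by
    refine aux_integrable P (by fun_prop) (Real.exp (l * C)) (fun w => ?_)
    rw [Real.abs_exp]
    gcongr
    exact (le_abs_self _).trans (hXb w)
  set B := 1 / (2 * (1 - l * C / 3)) with hB
  have hint1 : Integrable (fun w => 1 + l * X w) P := (integrable_const 1).add (hXi.const_mul l)
  calc ∫ w, Real.exp (l * X w) ∂P ≤ ∫ w, (1 + l * X w + B * l ^ 2 * X w ^ 2) ∂P := by
        refine integral_mono hei (hint1.add
          (hX2i.const_mul _)) (fun w => ?_)
        have := aux_exp_bound (x := l * X w) (c := l * C) (by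
          rw [abs_mul, abs_of_nonneg hl]; gcongr; exact hXb w) hlC
        have h2 : B * (l * X w) ^ 2 = B * l ^ 2 * X w ^ 2 := by ring
        rw [← hB, h2] at this
        exact this
    _ = _ := by
        rw [integral_add hint1 (hX2i.const_mul _),
          integral_add (integrable_const 1) (hXi.const_mul l), integral_const_mul,
          integral_const_mul]
        simp [integral_const_mul]

lemma aux_outer {Z V : Type*} [MeasurableSpace Z] [MeasurableSpace V]
    (D : Measure Z) (G : Measure V) [IsProbabilityMeasure D] [IsProbabilityMeasure G]
    (L U : ℝ) {f : Z × V → ℝ} (hf : Measurable f) (hbdd : ∀ z v, f (z, v) ∈ Set.Icc L U)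
    (n : ℕ) (hn : 0 < n) {l : ℝ} (hl : 0 ≤ l) (hlC : l * (U - L) < 3) :
    ∫ z, (∫ v, Real.exp (l / n * (truePerf D G f - f (z, v))) ∂G) ^ n ∂D ≤
      Real.exp (1 / (2 * (1 - l * (U - L) / 3)) * l ^ 2 *
        (sigma2WI D G f / n + sigma2AI D G f)) := by
  set u := truePerf D G f with hu
  set C := U - L with hC
  have hfb : ∀ p, |f p| ≤ max |L| |U| := fun p => abs_le_max_abs_abs (hbdd p.1 p.2).1 (hbdd p.1 p.2).2
  have hfi : Integrable f (D.prod G) := aux_integrable _ hf _ hfb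
  have hfz : ∀ z, Measurable fun v => f (z, v) := fun z => by fun_prop
  have hfzi : ∀ z, Integrable (fun v => f (z, v)) G := fun z =>
    aux_integrable _ (hfz z) _ (fun v => hfb _)
  have huL : L ≤ u ∧ u ≤ U := by
    constructor
    · have := integral_mono (integrable_const (μ := D.prod G) L) hfi (fun p => (hbdd p.1 p.2).1)
      simpa [hu, truePerf] using this
    · have := integral_mono hfi (integrable_const (μ := D.prod G) U) (fun p => (hbdd p.1 p.2).2)
      simpa [hu, truePerf] using this
  have hgb : ∀ z v, |u - f (z, v)| ≤ C := fun z v => by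
    have := hbdd z v
    rw [abs_le, hC]; constructor <;> linarith [this.1, this.2, huL.1, huL.2]
  have hIm : Measurable (instPerf G f) :=
    (hf.stronglyMeasurable.integral_prod_right' (ν := G)).measurable
  have hmean : ∀ z, ∫ v, (u - f (z, v)) ∂G = u - instPerf G f z := fun z => by
    rw [integral_sub (integrable_const _) (hfzi z)]
    simp [instPerf]
  have hmb : ∀ z, |u - instPerf G f z| ≤ C := fun z => by
    rw [← hmean]; exact aux_abs_integral G C (hgb z)
  set W : Z → ℝ := fun z => ∫ v, (f (z, v) - instPerf G f z) ^ 2 ∂G with hW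
  have hWm : Measurable W := by
    have : Measurable fun p : Z × V => (f p - instPerf G f p.1) ^ 2 := by fun_prop
    exact (this.stronglyMeasurable.integral_prod_right' (ν := G)).measurable
  have hWb : ∀ z, |W z| ≤ (C + C) ^ 2 := fun z => by
    refine aux_abs_integral G _ (fun v => ?_)
    rw [abs_pow]
    gcongr
    have : f (z, v) - instPerf G f z = (u - instPerf G f z) - (u - f (z, v)) := by ring
    rw [this]
    exact (abs_sub _ _).trans (add_le_add (hmb z) (hgb z v))
  have hvarz : ∀ z, ∫ v, ((u - f (z, v)) - ∫ w, (u - f (z, w)) ∂G) ^ 2 ∂G = W z := fun z => by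
    rw [hmean]
    refine integral_congr_ae (Filter.Eventually.of_forall fun v => ?_)
    simp only
    ring
  set B := 1 / (2 * (1 - l * C / 3)) with hB
  have key : ∀ z, (∫ v, Real.exp (l / n * (u - f (z, v))) ∂G) ^ n ≤
      1 + l * (u - instPerf G f z) + B * l ^ 2 * (W z / n + (u - instPerf G f z) ^ 2) := fun z => by
    have := aux_inner G (g := fun v => u - f (z, v)) (by fun_prop) (hgb z) n hn hl hlC
    rwa [hvarz, hmean] at this
  have hexpb : ∀ z v, |Real.exp (l / n * (u - f (z, v)))| ≤ Real.exp (l / n * C) := fun z v => by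
    rw [Real.abs_exp]
    gcongr
    exact (le_abs_self _).trans (hgb z v)
  have hLi : Integrable (fun z => (∫ v, Real.exp (l / n * (u - f (z, v))) ∂G) ^ n) D := by
    refine aux_integrable D ?_ (Real.exp (l / n * C) ^ n) (fun z => ?_)
    · have : Measurable fun p : Z × V => Real.exp (l / n * (u - f p)) := by fun_prop
      exact (this.stronglyMeasurable.integral_prod_right' (ν := G)).measurable.pow_const n
    · rw [abs_pow]
      gcongr
      exact aux_abs_integral G _ (hexpb z)
  have hmi : Integrable (fun z => u - instPerf G f z) D := aux_integrable D (by fun_prop) C hmb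
  have hm2i : Integrable (fun z => (u - instPerf G f z) ^ 2) D :=
    aux_integrable D (by fun_prop) (C ^ 2) (fun z => by rw [abs_pow]; gcongr; exact hmb z)
  have hWi : Integrable W D := aux_integrable D hWm _ hWb
  have hIi : Integrable (instPerf G f) D := hfi.integral_prod_left
  have hIu : ∫ z, instPerf G f z ∂D = u := (integral_prod f hfi).symm
  have hz : ∫ z, (u - instPerf G f z) ∂D = 0 := by
    rw [integral_sub (integrable_const _) hIi, hIu]; simp
  have hAI : ∫ z, (u - instPerf G f z) ^ 2 ∂D = sigma2AI D G f := by
    refine integral_congr_ae (Filter.Eventually.of_forall fun z => ?_)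
    simp only [hu]
    ring
  have hint1 : Integrable (fun z => 1 + l * (u - instPerf G f z)) D :=
    (integrable_const 1).add (hmi.const_mul l)
  have hint2 : Integrable (fun z => W z / n + (u - instPerf G f z) ^ 2) D :=
    (hWi.div_const _).add hm2i
  calc _ ≤ ∫ z, (1 + l * (u - instPerf G f z)
        + B * l ^ 2 * (W z / n + (u - instPerf G f z) ^ 2)) ∂D :=
        integral_mono hLi (hint1.add (hint2.const_mul _)) key
    _ = 1 + B * l ^ 2 * (sigma2WI D G f / n + sigma2AI D G f) := by
        rw [integral_add hint1 (hint2.const_mul _),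
          integral_add (integrable_const 1) (hmi.const_mul l), integral_const_mul,
          integral_const_mul, hz, integral_add (hWi.div_const _) hm2i, hAI, integral_div]
        simp [sigma2WI, hW]
    _ ≤ _ := by
        rw [add_comm]; exact Real.add_one_le_exp _

lemma aux_mgf {Z V : Type*} [MeasurableSpace Z] [MeasurableSpace V]
    (D : Measure Z) (G : Measure V) [IsProbabilityMeasure D] [IsProbabilityMeasure G]
    {g : Z × V → ℝ} (hg : Measurable g) (C : ℝ) (hC : ∀ p, |g p| ≤ C)
    (K N n : ℕ) (a : Fin N → Fin K) (ha : ∀ i, nCount a i = n) :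
    Integrable (fun ω : (Fin K → Z) × (Fin N → V) => ∏ t, g (ω.1 (a t), ω.2 t))
      (sampleMeasure D G K N) ∧
    ∫ ω, ∏ t, g (ω.1 (a t), ω.2 t) ∂(sampleMeasure D G K N)
      = (∫ z, (∫ v, g (z, v) ∂G) ^ n ∂D) ^ K := by
  have hint : Integrable (fun ω : (Fin K → Z) × (Fin N → V) => ∏ t, g (ω.1 (a t), ω.2 t))
      (sampleMeasure D G K N) := by
    unfold sampleMeasure
    refine aux_integrable _ (by fun_prop) (∏ _t : Fin N, C) (fun ω => ?_)
    rw [Finset.abs_prod]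
    exact Finset.prod_le_prod (fun _ _ => abs_nonneg _) (fun _ _ => hC _)
  refine ⟨hint, ?_⟩
  unfold sampleMeasure at hint ⊢
  rw [integral_prod _ hint]
  have h1 : ∀ z : Fin K → Z, ∫ v : Fin N → V, ∏ t, g (z (a t), v t) ∂(Measure.pi fun _ => G)
      = ∏ i, (∫ v, g (z i, v) ∂G) ^ n := fun z => by
    rw [integral_fintype_prod_eq_prod (fun t v => g (z (a t), v)),
      ← Finset.prod_fiberwise' Finset.univ a (fun i => ∫ v, g (z i, v) ∂G)]
    refine Finset.prod_congr rfl fun i _ => ?_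
    rw [Finset.prod_const, ← ha i]
    rfl
  simp only [h1]
  rw [integral_fintype_prod_eq_pow (fun z => (∫ v, g (z, v) ∂G) ^ n), Fintype.card_fin]

lemma aux_opt {c v ℓ : ℝ} (hc : 0 < c) (hv : 0 ≤ v) (hℓ : 0 < ℓ) :
    ∃ l : ℝ, 0 ≤ l ∧ l * c < 1 ∧
      -l * (2 * c * ℓ + Real.sqrt (2 * ℓ * v)) + 1 / (2 * (1 - l * c)) * l ^ 2 * v ≤ -ℓ := by
  rcases hv.eq_or_lt with rfl | hv
  · refine ⟨1 / (2 * c), by positivity, ?_, ?_⟩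
    · field_simp; norm_num
    · simp; field_simp; linarith
  · set q := Real.sqrt (2 * ℓ * v) with hq
    have hq0 : 0 < q := Real.sqrt_pos.mpr (by positivity)
    have hq2 : q ^ 2 = 2 * ℓ * v := Real.sq_sqrt (by positivity)
    -- with r = q / v the choice is r / (1 + c r) = q / (v + c q)
    have hd : 0 < v + c * q := by positivity
    refine ⟨q / (v + c * q), by positivity, ?_, ?_⟩
    · rw [div_mul_eq_mul_div, div_lt_one hd]; linarith
    · have h1 : 1 - q / (v + c * q) * c = v / (v + c * q) := by field_simp; ring
      rw [h1]
      have h2 : 1 / (2 * (v / (v + c * q))) * (q / (v + c * q)) ^ 2 * v = ℓ * v / (v + c * q) := by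
        rw [div_pow, hq2]; field_simp
      rw [h2]
      have h3 : -(q / (v + c * q)) * (2 * c * ℓ + q) = -(2 * c * ℓ * q + 2 * ℓ * v) / (v + c * q) := by
        rw [← hq2]; field_simp
      rw [h3, ← add_div, div_le_iff₀ hd]
      nlinarith [mul_pos (mul_pos hc hℓ) hq0]

open ProbabilityTheory in
lemma aux_tail {Z V : Type*} [MeasurableSpace Z] [MeasurableSpace V]
    (D : Measure Z) (G : Measure V) [IsProbabilityMeasure D] [IsProbabilityMeasure G]
    (L U : ℝ) (hLU : L < U) {f : Z × V → ℝ} (hf : Measurable f)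
    (hbdd : ∀ z v, f (z, v) ∈ Set.Icc L U)
    (K N n : ℕ) (hK : 0 < K) (hn : 0 < n) (hN : N = K * n) (a : Fin N → Fin K)
    (ha : ∀ i, nCount a i = n) (ℓ w : ℝ) (hℓ : 0 < ℓ)
    (hw : (1 / (N : ℝ)) * sigma2WI D G f + (1 / (K : ℝ)) * sigma2AI D G f ≤ w) (hw0 : 0 ≤ w) :
    (sampleMeasure D G K N).real {ω | 2 * (U - L) * ℓ / (3 * (K : ℝ)) + Real.sqrt (2 * ℓ * w) ≤
      truePerf D G f - (1 / (N : ℝ)) * ∑ t : Fin N, f (ω.1 (a t), ω.2 t)} ≤ Real.exp (-ℓ) := by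
  have hK' : (0 : ℝ) < K := by exact_mod_cast hK
  have hn' : (0 : ℝ) < n := by exact_mod_cast hn
  have hN' : (N : ℝ) = K * n := by exact_mod_cast hN
  have : IsProbabilityMeasure (sampleMeasure D G K N) := by unfold sampleMeasure; infer_instance
  obtain ⟨l, hl, hlc, hopt⟩ := aux_opt (c := (U - L) / 3) (v := K ^ 2 * w) (by linarith)
    (by positivity) hℓ
  have hlC : l * (U - L) < 3 := by linarith
  set u := truePerf D G f with hu
  set X : (Fin K → Z) × (Fin N → V) → ℝ :=
    fun ω => u - (1 / (N : ℝ)) * ∑ t : Fin N, f (ω.1 (a t), ω.2 t) with hX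
  have hprod : ∀ ω, Real.exp (K * l * X ω) =
      ∏ t, (fun p => Real.exp (l / n * (u - f p))) (ω.1 (a t), ω.2 t) := fun ω => by
    simp only
    rw [← Real.exp_sum, ← Finset.mul_sum, Finset.sum_sub_distrib]
    simp only [hX, Finset.sum_const, Finset.card_univ, Fintype.card_fin, nsmul_eq_mul, hN']
    congr 1
    field_simp
  have hm := aux_mgf D G (g := fun p => Real.exp (l / n * (u - f p))) (by fun_prop)
    (Real.exp (l / n * (u - L))) (fun p => by
      rw [Real.abs_exp]; gcongr; exact (hbdd p.1 p.2).1) K N n a ha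
  simp only [← hprod] at hm
  have hch := measure_ge_le_exp_mul_mgf (μ := sampleMeasure D G K N) (X := X) (t := K * l)
    (2 * (U - L) * ℓ / (3 * (K : ℝ)) + Real.sqrt (2 * ℓ * w)) (by positivity) hm.1
  refine hch.trans ?_
  rw [mgf, hm.2]
  have hout := aux_outer D G L U hf hbdd n hn hl hlC
  rw [← hu] at hout
  have hsq : Real.sqrt (2 * ℓ * (K ^ 2 * w)) = K * Real.sqrt (2 * ℓ * w) := by
    rw [show 2 * ℓ * (K ^ 2 * w) = (K : ℝ) ^ 2 * (2 * ℓ * w) by ring,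
      Real.sqrt_mul (by positivity), Real.sqrt_sq hK'.le]
  calc _ ≤ Real.exp (-(K * l) * (2 * (U - L) * ℓ / (3 * (K : ℝ)) + Real.sqrt (2 * ℓ * w))) *
        (Real.exp (1 / (2 * (1 - l * (U - L) / 3)) * l ^ 2 *
          (sigma2WI D G f / n + sigma2AI D G f))) ^ K := by
        gcongr
    _ = Real.exp (-(K * l) * (2 * (U - L) * ℓ / (3 * (K : ℝ)) + Real.sqrt (2 * ℓ * w)) +
        1 / (2 * (1 - l * (U - L) / 3)) * l ^ 2 * (K ^ 2 *
          ((1 / (N : ℝ)) * sigma2WI D G f + (1 / (K : ℝ)) * sigma2AI D G f))) := by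
        rw [← Real.exp_nat_mul, ← Real.exp_add, hN']
        congr 2
        field_simp
    _ ≤ Real.exp (-(K * l) * (2 * (U - L) * ℓ / (3 * (K : ℝ)) + Real.sqrt (2 * ℓ * w)) +
        1 / (2 * (1 - l * (U - L) / 3)) * l ^ 2 * (K ^ 2 * w)) := by
        have : 0 < 1 - l * (U - L) / 3 := by linarith
        gcongr
    _ ≤ Real.exp (-ℓ) := by
        rw [Real.exp_le_exp]
        refine le_trans (le_of_eq ?_) hopt
        rw [hsq, mul_div_assoc l]
        congr 1
        field_simp

/-- **Uniform estimation-error bound for the balanced estimator when `K ∣ N`.**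
Suppose `Θ = {θ_1,…,θ_m}` is finite, `K` divides `N`, and the balanced
experimental setting `n_i = N/K` for all `i` is used. Let `θ†` maximize
`τ²_θ` and set `σ²_WI = σ²_WI(θ†)`, `σ²_AI = σ²_AI(θ†)`, `C = U − L`.
Then for any `0 < δ < 1`, with probability at least `1 − δ`,
`sup_{θ∈Θ} [u(θ) − û_{S_N}(θ)] ≤ (2C·ln(m/δ))/(3K)
  + sqrt(2·ln(m/δ)·((1/N)·σ²_WI + (1/K)·σ²_AI))`. -/
theorem balanced_finite_space_uniform_error_bound
    {Z V Θ : Type*} [MeasurableSpace Z] [MeasurableSpace V]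
    [Fintype Θ] [Nonempty Θ]
    (D : Measure Z) (G : Measure V)
    [IsProbabilityMeasure D] [IsProbabilityMeasure G]
    (L U : ℝ) (hLU : L ≤ U)
    (f : Θ → Z × V → ℝ) (hf : ∀ θ, Measurable (f θ))
    (hbdd : ∀ θ z v, f θ (z, v) ∈ Set.Icc L U)
    (K N : ℕ) (hK : 1 ≤ K) (hN : 1 ≤ N) (hdvd : K ∣ N)
    (a : Fin N → Fin K)
    (ha_bal : ∀ i, nCount a i = N / K)
    (θd : Θ) (hθd : ∀ θ, tau2 D G (f θ) a ≤ tau2 D G (f θd) a)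
    (δ : ℝ) (hδ0 : 0 < δ) (hδ1 : δ < 1) :
    (1 : ℝ) - δ ≤
      (sampleMeasure D G K N
        {ω : (Fin K → Z) × (Fin N → V) |
          (⨆ θ : Θ, (truePerf D G (f θ)
              - (1 / (N : ℝ)) * ∑ t : Fin N, f θ (ω.1 (a t), ω.2 t)))
          ≤ 2 * (U - L) * Real.log ((Fintype.card Θ : ℝ) / δ) / (3 * (K : ℝ))
            + Real.sqrt (2 * Real.log ((Fintype.card Θ : ℝ) / δ)
                * ((1 / (N : ℝ)) * sigma2WI D G (f θd)
                  + (1 / (K : ℝ)) * sigma2AI D G (f θd)))}).toReal := by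
  have hK' : (0 : ℝ) < K := by exact_mod_cast hK
  obtain ⟨n, hNn⟩ := hdvd
  have hn : 0 < n := by
    rcases Nat.eq_zero_or_pos n with h | h
    · subst h; omega
    · exact h
  have hn' : (0 : ℝ) < n := by exact_mod_cast hn
  have hN' : (N : ℝ) = K * n := by exact_mod_cast hNn
  have ha : ∀ i, nCount a i = n := fun i => by
    rw [ha_bal i, hNn, Nat.mul_div_cancel_left _ (by omega)]
  have : IsProbabilityMeasure (sampleMeasure D G K N) := by unfold sampleMeasure; infer_instance
  have hm1 : (1 : ℝ) ≤ Fintype.card Θ := by exact_mod_cast Fintype.card_pos (α := Θ)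
  have hmpos : (0 : ℝ) < Fintype.card Θ := by linarith
  set ℓ := Real.log ((Fintype.card Θ : ℝ) / δ) with hℓdef
  have hℓ : 0 < ℓ := Real.log_pos (by rw [lt_div_iff₀ hδ0]; linarith)
  have hexp : Real.exp (-ℓ) = δ / Fintype.card Θ := by
    rw [Real.exp_neg, hℓdef, Real.exp_log (by positivity), inv_div]
  set w := (1 / (N : ℝ)) * sigma2WI D G (f θd) + (1 / (K : ℝ)) * sigma2AI D G (f θd) with hw
  have htau : ∀ θ, tau2 D G (f θ) a / N =
      (1 / (N : ℝ)) * sigma2WI D G (f θ) + (1 / (K : ℝ)) * sigma2AI D G (f θ) := fun θ => by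
    simp only [tau2, ha, Finset.sum_const, Finset.card_univ, Fintype.card_fin, nsmul_eq_mul, hN']
    field_simp
  have hwθ : ∀ θ, (1 / (N : ℝ)) * sigma2WI D G (f θ) + (1 / (K : ℝ)) * sigma2AI D G (f θ) ≤ w :=
    fun θ => by
      rw [hw, ← htau, ← htau]
      have := hθd θ
      gcongr
  have hw0 : 0 ≤ w := by
    have h1 : 0 ≤ sigma2WI D G (f θd) :=
      integral_nonneg fun z => integral_nonneg fun v => sq_nonneg _
    have h2 : 0 ≤ sigma2AI D G (f θd) := integral_nonneg fun z => sq_nonneg _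
    positivity
  set R := 2 * (U - L) * ℓ / (3 * (K : ℝ)) + Real.sqrt (2 * ℓ * w) with hR
  set S := {ω : (Fin K → Z) × (Fin N → V) | (⨆ θ : Θ, (truePerf D G (f θ)
              - (1 / (N : ℝ)) * ∑ t : Fin N, f θ (ω.1 (a t), ω.2 t))) ≤ R} with hS
  change 1 - δ ≤ (sampleMeasure D G K N).real S
  rcases hLU.eq_or_lt with hLU | hLU
  · have hR0 : 0 ≤ R := by
      have : 0 ≤ U - L := by linarith
      positivity
    have hconst : ∀ θ p, f θ p = L := fun θ p => by
      have := hbdd θ p.1 p.2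
      exact le_antisymm (by rw [hLU]; exact this.2) this.1
    have hSu : S = Set.univ := by
      refine Set.eq_univ_of_forall fun ω => ?_
      rw [hS, Set.mem_ofPred_eq]
      refine ciSup_le fun θ => ?_
      refine le_trans (le_of_eq ?_) hR0
      simp only [truePerf, hconst]
      have : (N : ℝ) ≠ 0 := by rw [hN']; positivity
      simp
      field_simp
      simp
    rw [hSu]
    simp
    exact hδ0.le
  · set E : Θ → Set ((Fin K → Z) × (Fin N → V)) := fun θ => {ω | R ≤ truePerf D G (f θ)
              - (1 / (N : ℝ)) * ∑ t : Fin N, f θ (ω.1 (a t), ω.2 t)} with hE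
    have hsub : Sᶜ ⊆ ⋃ θ, E θ := by
      intro ω hω
      by_contra hcon
      apply hω
      rw [hS, Set.mem_ofPred_eq]
      refine ciSup_le fun θ => ?_
      by_contra h
      exact hcon (Set.mem_iUnion.mpr ⟨θ, (not_le.mp h).le⟩)
    have hbad : (sampleMeasure D G K N).real Sᶜ ≤ δ := by
      calc _ ≤ (sampleMeasure D G K N).real (⋃ θ, E θ) := measureReal_mono hsub
        _ ≤ ∑ θ, (sampleMeasure D G K N).real (E θ) := measureReal_iUnion_fintype_le _
        _ ≤ ∑ _θ : Θ, δ / Fintype.card Θ := by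
            refine Finset.sum_le_sum fun θ _ => ?_
            rw [← hexp]
            exact aux_tail D G L U hLU (hf θ) (hbdd θ) K N n (by omega) hn hNn a ha ℓ w hℓ
              (hwθ θ) hw0
        _ = δ := by
            simp
            field_simp
    have h1 : (1 : ℝ) ≤ (sampleMeasure D G K N).real S + (sampleMeasure D G K N).real Sᶜ := by
      have := measureReal_union_le (μ := sampleMeasure D G K N) S Sᶜ
      rwa [Set.union_compl_self, probReal_univ] at this
    linarith
end
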